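/- arXiv:2306.06520 — 3 statements merged into one kernel-verified Lean document; each statement's English description precedes it below -/
import Mathlib

section
/- Let τ > 0 and D > 0 be real numbers, set κ = D²/4, let x_f, x_f' ∈ ℝⁿ, let G : ℝ → ℝⁿ be any function (the forcing term evaluated along the clock signal), and let x, x' : ℝ → ℝⁿ be twice differentiable functions satisfying, for all t ∈ [0, t_f], the differential equations −τ²·x''(t) + κ·(x_f − x(t)) − D·τ·x'(t) = G(t) and −τ²·(x')''(t) + κ·(x_f' − x'(t)) − D·τ·(x')'(t) = G(t), with the same initial conditions x(0) = x'(0) and ẋ(0) = ẋ'(0). Then for all t ∈ [0, t_f], ‖x(t) − x'(t)‖ = |e^{−Dt/(2τ)}·(−Dt/(2τ) − 1) + 1| · ‖x_f − x_f'‖. -/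
/-- Solution formula on `[0, T]` for the critically damped linear equation
`z'' + 2 a z' + a² z = 0`. -/
theorem exp_smul_eq_of_critically_damped {E : Type*} [NormedAddCommGroup E] [NormedSpace ℝ E]
    {a T : ℝ} {z z₁ z₂ : ℝ → E} (hz : ∀ t, HasDerivAt z (z₁ t) t)
    (hz₁ : ∀ t, HasDerivAt z₁ (z₂ t) t)
    (hode : ∀ t ∈ Set.Icc (0 : ℝ) T, z₂ t + (2 * a) • z₁ t + a ^ 2 • z t = 0) :
    ∀ t ∈ Set.Icc (0 : ℝ) T, Real.exp (a * t) • z t = z 0 + t • (z₁ 0 + a • z 0) := by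
  have hexp (t : ℝ) : HasDerivAt (fun s => Real.exp (a * s)) (Real.exp (a * t) * a) t := by
    simpa using ((hasDerivAt_id t).const_mul a).exp
  have hw (t : ℝ) := (hexp t).smul ((hz₁ t).add ((hz t).const_smul a))
  have hw_const : ∀ t ∈ Set.Icc (0 : ℝ) T,
      Real.exp (a * t) • (z₁ t + a • z t) = z₁ 0 + a • z 0 := by
    intro t ht
    have h := constant_of_has_deriv_right_zero
      (fun s _ => (hw s).continuousAt.continuousWithinAt) (fun s hs => ?_) t ht
    · simpa using h
    · refine ((hw s).congr_deriv ?_).hasDerivWithinAt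
      have h := congrArg (Real.exp (a * s) • ·) (hode s (Set.Ico_subset_Icc_self hs))
      simp only [smul_zero] at h
      rw [← h]
      simp only [Pi.add_apply, Pi.smul_apply]
      module
  have hu (t : ℝ) := ((hexp t).smul (hz t)).sub ((hasDerivAt_id t).smul_const (z₁ 0 + a • z 0))
  intro t ht
  have h := constant_of_has_deriv_right_zero
    (fun s _ => (hu s).continuousAt.continuousWithinAt) (fun s hs => ?_) t ht
  · simpa [sub_eq_iff_eq_add] using h
  · refine ((hu s).congr_deriv ?_).hasDerivWithinAt
    rw [← hw_const s (Set.Ico_subset_Icc_self hs)]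
    module


/-- Proposition 2 of the paper: two DMP trajectories with the same forcing term,
parameters `τ, D` with `κ = D²/4`, and the same initial position and velocity, but
goals `x_f` and `x_f'`, satisfy
`‖x(t) − x'(t)‖ = |e^{−Dt/(2τ)}(−Dt/(2τ) − 1) + 1| ⬝ ‖x_f − x_f'‖` for all `t ∈ [0, t_f]`. -/
theorem dmp_goal_perturbation_norm_eq
    {n : ℕ} (τ D t_f κ : ℝ) (hτ : 0 < τ) (hD : 0 < D) (hκ : κ = D ^ 2 / 4)
    (xf xf' : EuclideanSpace ℝ (Fin n)) (G : ℝ → EuclideanSpace ℝ (Fin n))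
    (x x' : ℝ → EuclideanSpace ℝ (Fin n))
    (hx₁ : Differentiable ℝ x) (hx₂ : Differentiable ℝ (deriv x))
    (hx'₁ : Differentiable ℝ x') (hx'₂ : Differentiable ℝ (deriv x'))
    (hodex : ∀ t ∈ Set.Icc (0 : ℝ) t_f,
      (-(τ ^ 2)) • deriv (deriv x) t + κ • (xf - x t) - (D * τ) • deriv x t = G t)
    (hodex' : ∀ t ∈ Set.Icc (0 : ℝ) t_f,
      (-(τ ^ 2)) • deriv (deriv x') t + κ • (xf' - x' t) - (D * τ) • deriv x' t = G t)
    (h0 : x 0 = x' 0) (h0' : deriv x 0 = deriv x' 0) :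
    ∀ t ∈ Set.Icc (0 : ℝ) t_f,
      ‖x t - x' t‖ =
        |Real.exp (-(D * t) / (2 * τ)) * (-(D * t) / (2 * τ) - 1) + 1| * ‖xf - xf'‖ := by
  intro t ht
  have hz (s : ℝ) : HasDerivAt (fun s => x s - x' s - (xf - xf')) (deriv x s - deriv x' s) s :=
    ((hx₁ s).hasDerivAt.sub (hx'₁ s).hasDerivAt).sub_const _
  have hz₁ (s : ℝ) : HasDerivAt (fun s => deriv x s - deriv x' s)
      (deriv (deriv x) s - deriv (deriv x') s) s :=
    (hx₂ s).hasDerivAt.sub (hx'₂ s).hasDerivAt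
  have hode : ∀ s ∈ Set.Icc (0 : ℝ) t_f,
      (deriv (deriv x) s - deriv (deriv x') s) + (2 * (D / (2 * τ))) • (deriv x s - deriv x' s)
        + (D / (2 * τ)) ^ 2 • (x s - x' s - (xf - xf')) = 0 := by
    intro s hs
    have h := sub_eq_zero.mpr ((hodex s hs).trans (hodex' s hs).symm)
    rw [hκ] at h
    refine (smul_eq_zero_iff_right (neg_ne_zero.mpr (pow_ne_zero 2 hτ.ne'))).mp (Eq.trans ?_ h)
    match_scalars <;> field_simp <;> ring
  have hsol := exp_smul_eq_of_critically_damped hz hz₁ hode t ht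
  have hdiff : x t - x' t =
      (Real.exp (-(D * t) / (2 * τ)) * (-(D * t) / (2 * τ) - 1) + 1) • (xf - xf') := by
    have harg : -(D * t) / (2 * τ) = -(D / (2 * τ) * t) := by ring
    have h := congrArg (Real.exp (-(D / (2 * τ) * t)) • ·) hsol
    simp only [smul_smul, ← Real.exp_add, neg_add_cancel, Real.exp_zero, one_smul, h0, h0',
      sub_self, zero_sub, zero_add] at h
    rw [harg, sub_eq_iff_eq_add.mp h]
    module
  rw [hdiff, norm_smul, Real.norm_eq_abs]
end

section
/- Let τ > 0, D > 0, α > 0, set κ = D²/4, let x_f ∈ ℝⁿ, and let F : ℝ → ℝⁿ be a function that is continuous at 0 with F(0) = 0. Let x : [0, ∞) → ℝⁿ be a twice differentiable function satisfying, for all t ≥ 0, −τ²·ẍ(t) + κ·(x_f − x(t)) − D·τ·ẋ(t) = F(e^{−(α/τ)t}). Then x(t) → x_f and ẋ(t) → 0 as t → ∞. -/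
open Filter Topology in
/-- A differentiable curve `z` with `z' + c z → 0` for some `c > 0` tends to `0`. -/
theorem tendsto_zero_of_tendsto_deriv_add_smul {E : Type*} [NormedAddCommGroup E]
    [NormedSpace ℝ E] {c : ℝ} (hc : 0 < c) {z : ℝ → E} (hz : Differentiable ℝ z)
    (h : Tendsto (fun t => deriv z t + c • z t) atTop (𝓝 0)) :
    Tendsto z atTop (𝓝 0) := by
  rw [Metric.tendsto_nhds]
  intro ε hε
  have hg : ∀ᶠ t in atTop, ‖deriv z t + c • z t‖ < c * (ε / 2) := by
    simpa using Metric.tendsto_nhds.1 h (c * (ε / 2)) (by positivity)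
  obtain ⟨T, hT⟩ := eventually_atTop.1 hg
  have hexp (t : ℝ) : HasDerivAt (fun s => Real.exp (c * s)) (Real.exp (c * t) * c) t := by
    simpa using ((hasDerivAt_id t).const_mul c).exp
  have hu (t : ℝ) : HasDerivAt (fun s => Real.exp (c * s) • z s)
      (Real.exp (c * t) • (deriv z t + c • z t)) t := by
    rw [smul_add, smul_smul]
    exact (hexp t).smul (hz t).hasDerivAt
  have hdecay : Tendsto (fun t => Real.exp (-(c * t)) * ‖Real.exp (c * T) • z T‖)
      atTop (𝓝 0) := by
    simpa using (Real.tendsto_exp_neg_atTop_nhds_zero.comp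
      (tendsto_id.const_mul_atTop hc)).mul_const ‖Real.exp (c * T) • z T‖
  filter_upwards [eventually_ge_atTop T, hdecay.eventually_lt_const (half_pos hε)] with t ht hsmall
  have hbound : ‖Real.exp (c * t) • z t‖ ≤
      ‖Real.exp (c * T) • z T‖ + ε / 2 * (Real.exp (c * t) - Real.exp (c * T)) := by
    refine image_norm_le_of_norm_deriv_right_le_deriv_boundary (a := T) (b := t)
      (f' := fun s => Real.exp (c * s) • (deriv z s + c • z s))
      (B := fun s => ‖Real.exp (c * T) • z T‖ + ε / 2 * (Real.exp (c * s) - Real.exp (c * T)))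
      (B' := fun s => ε / 2 * (Real.exp (c * s) * c))
      (fun s _ => (hu s).continuousAt.continuousWithinAt)
      (fun s _ => (hu s).hasDerivWithinAt) (by simp)
      (fun s => (((hexp s).sub_const _).const_mul _).const_add _) ?_ (Set.right_mem_Icc.2 ht)
    intro s hs
    rw [norm_smul, Real.norm_of_nonneg (Real.exp_pos _).le]
    calc Real.exp (c * s) * ‖deriv z s + c • z s‖
        ≤ Real.exp (c * s) * (c * (ε / 2)) := by gcongr; exact (hT s hs.1).le
      _ = ε / 2 * (Real.exp (c * s) * c) := by ring
  rw [norm_smul, Real.norm_of_nonneg (Real.exp_pos _).le] at hbound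
  rw [Real.exp_neg, inv_mul_lt_iff₀ (Real.exp_pos _)] at hsmall
  rw [dist_zero_right]
  refine lt_of_mul_lt_mul_left ?_ (Real.exp_pos (c * t)).le
  nlinarith [mul_pos hε (Real.exp_pos (c * T))]

/-- Theorem 1 of the paper (global asymptotic stability of the DMP goal):
if `κ = D²/4` and the forcing term `F` is continuous at `0` with `F(0) = 0`, then
every twice differentiable solution of
`−τ²ẍ(t) + κ(x_f − x(t)) − Dτẋ(t) = F(e^{−(α/τ)t})` on `t ≥ 0` satisfies
`x(t) → x_f` and `ẋ(t) → 0` as `t → ∞`. -/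
theorem dmp_goal_global_asymptotic_stability
    {n : ℕ} (τ D α κ : ℝ) (hτ : 0 < τ) (hD : 0 < D) (hα : 0 < α)
    (hκ : κ = D ^ 2 / 4)
    (xf : EuclideanSpace ℝ (Fin n)) (F : ℝ → EuclideanSpace ℝ (Fin n))
    (hF0 : F 0 = 0) (hFcont : ContinuousAt F 0)
    (x : ℝ → EuclideanSpace ℝ (Fin n))
    (hx₁ : Differentiable ℝ x) (hx₂ : Differentiable ℝ (deriv x))
    (hode : ∀ t : ℝ, 0 ≤ t →
      (-(τ ^ 2)) • deriv (deriv x) t + κ • (xf - x t) - (D * τ) • deriv x t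
        = F (Real.exp (-(α / τ) * t))) :
    Filter.Tendsto x Filter.atTop (nhds xf) ∧
    Filter.Tendsto (deriv x) Filter.atTop (nhds 0) := by
  set c := D / (2 * τ) with hc_def
  have hc : 0 < c := by positivity
  have hy : Differentiable ℝ fun t => x t - xf := hx₁.sub_const xf
  have hdy : deriv (fun t => x t - xf) = deriv x := by
    funext t
    simp
  have hz : Differentiable ℝ fun t => deriv x t + c • (x t - xf) :=
    hx₂.add (hy.const_smul c)
  have hdz (t : ℝ) : deriv (fun s => deriv x s + c • (x s - xf)) t =
      deriv (deriv x) t + c • deriv x t :=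
    ((hx₂ t).hasDerivAt.add (((hx₁ t).hasDerivAt.sub_const xf).const_smul c)).deriv
  have hs : Filter.Tendsto (fun t => Real.exp (-(α / τ) * t)) Filter.atTop (nhds 0) := by
    simpa [Function.comp_def] using Real.tendsto_exp_neg_atTop_nhds_zero.comp
      (Filter.tendsto_id.const_mul_atTop (div_pos hα hτ))
  have hF : Filter.Tendsto (fun t => (-(τ ^ 2)⁻¹) • F (Real.exp (-(α / τ) * t)))
      Filter.atTop (nhds 0) := by
    have hF' := hFcont.tendsto
    rw [hF0] at hF'
    simpa using (hF'.comp hs).const_smul (-(τ ^ 2)⁻¹)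
  have hz0 : Filter.Tendsto (fun t => deriv x t + c • (x t - xf)) Filter.atTop (nhds 0) := by
    refine tendsto_zero_of_tendsto_deriv_add_smul hc hz (hF.congr' ?_)
    filter_upwards [Filter.eventually_ge_atTop 0] with t ht
    rw [hdz, ← hode t ht, hκ, hc_def]
    match_scalars <;> field_simp <;> ring
  have hy0 : Filter.Tendsto (fun t => x t - xf) Filter.atTop (nhds 0) :=
    tendsto_zero_of_tendsto_deriv_add_smul hc hy (by simpa only [hdy] using hz0)
  refine ⟨tendsto_sub_nhds_zero_iff.1 hy0, ?_⟩
  simpa using hz0.sub (hy0.const_smul c)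
end

section
/- Let τ > 0 and D > 0, set κ = D²/4, let x_f, x_f' ∈ ℝⁿ, let G : ℝ → ℝⁿ, and let x, x' : ℝ → ℝⁿ be twice differentiable functions satisfying, for all t ∈ [0, t_f], −τ²·x''(t) + κ·(x_f − x(t)) − D·τ·x'(t) = G(t) and −τ²·(x')''(t) + κ·(x_f' − x'(t)) − D·τ·(x')'(t) = G(t), with x(0) = x'(0) and ẋ(0) = ẋ'(0). Then for all t ∈ [0, t_f], ‖x(t) − x'(t)‖ < ‖x_f − x_f'‖ whenever x_f ≠ x_f'; equivalently, for all s ≥ 0 one has 0 ≤ 1 − e^{−s}(1 + s) < 1. -/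
open Set in
/-- Explicit solution of the critically damped oscillator equation in terms of the
initial position and velocity. -/
theorem critically_damped_solution {E : Type*} [NormedAddCommGroup E] [NormedSpace ℝ E]
    {c T : ℝ} {u v : ℝ → E} (hu : ∀ t ∈ Icc 0 T, HasDerivAt u (v t) t)
    (hv : ∀ t ∈ Icc 0 T, HasDerivAt v (-(2 * c) • v t - c ^ 2 • u t) t) {t : ℝ}
    (ht : t ∈ Icc 0 T) :
    u t = Real.exp (-(c * t)) • (u 0 + t • (v 0 + c • u 0)) := by
  have hexp (s : ℝ) : HasDerivAt (fun r => Real.exp (c * r)) (Real.exp (c * s) * c) s := by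
    simpa using ((hasDerivAt_id s).const_mul c).exp
  have hA : ∀ s ∈ Icc 0 T,
      HasDerivAt (fun r => Real.exp (c * r) • (v r + c • u r)) 0 s := by
    intro s hs
    refine ((hexp s).smul ((hv s hs).add ((hu s hs).const_smul c))).congr_deriv ?_
    simp only [Pi.add_apply, Pi.smul_apply]
    module
  have hA0 : ∀ s ∈ Icc 0 T, Real.exp (c * s) • (v s + c • u s) = v 0 + c • u 0 := by
    intro s hs
    have h := constant_of_has_deriv_right_zero
      (fun r hr => (hA r hr).continuousAt.continuousWithinAt)
      (fun r hr => (hA r (Ico_subset_Icc_self hr)).hasDerivWithinAt) s hs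
    simpa using h
  have hB : ∀ s ∈ Icc 0 T,
      HasDerivAt (fun r => Real.exp (c * r) • u r - r • (v 0 + c • u 0)) 0 s := by
    intro s hs
    refine (((hexp s).smul (hu s hs)).sub
      ((hasDerivAt_id s).smul_const (v 0 + c • u 0))).congr_deriv ?_
    rw [← hA0 s hs]
    module
  have h := constant_of_has_deriv_right_zero
    (fun r hr => (hB r hr).continuousAt.continuousWithinAt)
    (fun r hr => (hB r (Ico_subset_Icc_self hr)).hasDerivWithinAt) t ht
  have h' : Real.exp (c * t) • u t = u 0 + t • (v 0 + c • u 0) := by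
    rw [← sub_eq_iff_eq_add]
    simpa using h
  rw [← h', smul_smul, ← Real.exp_add]
  simp

theorem one_sub_exp_neg_mul_one_add_mem_Ico {s : ℝ} (hs : 0 ≤ s) :
    1 - Real.exp (-s) * (1 + s) ∈ Set.Ico (0 : ℝ) 1 := by
  have hle : Real.exp (-s) * (1 + s) ≤ Real.exp (-s) * Real.exp s := by
    gcongr
    linarith [Real.add_one_le_exp s]
  rw [← Real.exp_add, neg_add_cancel, Real.exp_zero] at hle
  have hpos : 0 < Real.exp (-s) * (1 + s) := by positivity
  constructor <;> linarith

/-- Quantitative upper bound derived from Proposition 2: under the hypotheses of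
Proposition 2, whenever `x_f ≠ x_f'` the distance between the two DMP trajectories
at every time `t ∈ [0, t_f]` is strictly less than `‖x_f − x_f'‖`; equivalently,
for every `s ≥ 0` one has `0 ≤ 1 − e^{−s}(1 + s) < 1`. -/
theorem dmp_goal_perturbation_strict_bound
    {n : ℕ} (τ D t_f κ : ℝ) (hτ : 0 < τ) (hD : 0 < D) (hκ : κ = D ^ 2 / 4)
    (xf xf' : EuclideanSpace ℝ (Fin n)) (G : ℝ → EuclideanSpace ℝ (Fin n))
    (x x' : ℝ → EuclideanSpace ℝ (Fin n))
    (hx₁ : Differentiable ℝ x) (hx₂ : Differentiable ℝ (deriv x))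
    (hx'₁ : Differentiable ℝ x') (hx'₂ : Differentiable ℝ (deriv x'))
    (hodex : ∀ t ∈ Set.Icc (0 : ℝ) t_f,
      (-(τ ^ 2)) • deriv (deriv x) t + κ • (xf - x t) - (D * τ) • deriv x t = G t)
    (hodex' : ∀ t ∈ Set.Icc (0 : ℝ) t_f,
      (-(τ ^ 2)) • deriv (deriv x') t + κ • (xf' - x' t) - (D * τ) • deriv x' t = G t)
    (h0 : x 0 = x' 0) (h0' : deriv x 0 = deriv x' 0) :
    (xf ≠ xf' → ∀ t ∈ Set.Icc (0 : ℝ) t_f, ‖x t - x' t‖ < ‖xf - xf'‖) ∧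
    (∀ s : ℝ, 0 ≤ s →
      0 ≤ 1 - Real.exp (-s) * (1 + s) ∧ 1 - Real.exp (-s) * (1 + s) < 1) := by
  refine ⟨fun hne t ht => ?_, fun s hs => one_sub_exp_neg_mul_one_add_mem_Ico hs⟩
  have hu : ∀ s ∈ Set.Icc 0 t_f, HasDerivAt (fun r => x r - x' r - (xf - xf'))
      (deriv x s - deriv x' s) s := fun s _ =>
    ((hx₁ s).hasDerivAt.sub (hx'₁ s).hasDerivAt).sub_const _
  have hv : ∀ s ∈ Set.Icc 0 t_f, HasDerivAt (fun r => deriv x r - deriv x' r)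
      (-(2 * (D / (2 * τ))) • (deriv x s - deriv x' s)
        - (D / (2 * τ)) ^ 2 • (x s - x' s - (xf - xf'))) s := by
    intro s hs
    refine ((hx₂ s).hasDerivAt.sub (hx'₂ s).hasDerivAt).congr_deriv ?_
    have h := (hodex s hs).trans (hodex' s hs).symm
    have hτ2 : τ ^ 2 ≠ 0 := by positivity
    refine smul_right_injective _ hτ2 ?_
    have e1 : τ ^ 2 * -(2 * (D / (2 * τ))) = -(D * τ) := by field_simp
    have e2 : τ ^ 2 * (D / (2 * τ)) ^ 2 = κ := by rw [hκ]; field_simp; norm_num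
    simp only [smul_sub _ (_ • _) (_ • _), smul_smul, e1, e2]
    linear_combination (norm := module) -h
  have hsol := critically_damped_solution hu hv ht
  simp only [h0, h0', sub_self, zero_sub, zero_add] at hsol
  set c := D / (2 * τ)
  have hform : x t - x' t = (1 - Real.exp (-(c * t)) * (1 + c * t)) • (xf - xf') := by
    rw [sub_eq_iff_eq_add.mp hsol]
    module
  have hc : 0 ≤ c * t := mul_nonneg (by positivity) ht.1
  obtain ⟨hlo, hhi⟩ := one_sub_exp_neg_mul_one_add_mem_Ico hc
  rw [hform, norm_smul, Real.norm_of_nonneg hlo]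
  exact mul_lt_of_lt_one_left (norm_pos_iff.mpr (sub_ne_zero.mpr hne)) hhi
end
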